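/- (Proposition 1, differential passivity of the closed-loop flexible-joint robot error dynamics.) Let n ∈ ℕ. For • ∈ {ℓ, m} let M_• : ℝ → (n×n real matrices) be differentiable with M_•(t) symmetric positive definite; let S_• : ℝ → (n×n real matrices) with S_•(t) skew-symmetric; let D_• : ℝ → (n×n real matrices) with D_•(t) symmetric positive semidefinite; let K_{•d} be symmetric positive semidefinite; let Π_• : ℝ → (n×n real matrices) be differentiable with Π_•(t) symmetric positive definite; and let A_• : ℝ → (n×n real matrices) satisfy ⟨z, (Π_•'(t) − Π_•(t) A_•(t) − A_•(t)ᵀ Π_•(t)) z⟩ ≤ 0 for all z and t. Let K be an n×n matrix (the joint stiffness). Suppose δq_ℓ, δq_m, δσ_ℓ, δσ_m : ℝ → ℝⁿ are differentiable and δω : ℝ → ℝⁿ is such that, for all t: δq_ℓ' = −A_ℓ δq_ℓ + M_ℓ⁻¹ δσ_ℓ; δq_m' = −A_m δq_m − Π_m⁻¹ Kᵀ M_ℓ⁻¹ δσ_ℓ + M_m⁻¹ δσ_m; δσ_ℓ' = −Π_ℓ δq_ℓ + K δq_m − (S_ℓ − (1/2) M_ℓ' + D_ℓ + K_{ℓd})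 M_ℓ⁻¹ δσ_ℓ; δσ_m' = −Π_m δq_m − (S_m − (1/2) M_m' + D_m + K_{md}) M_m⁻¹ δσ_m + δω. Then V(t) := (1/2)[⟨δq_ℓ, Π_ℓ δq_ℓ⟩ + ⟨δσ_ℓ, M_ℓ⁻¹ δσ_ℓ⟩ + ⟨δq_m, Π_m δq_m⟩ + ⟨δσ_m, M_m⁻¹ δσ_m⟩](t) satisfies V'(t) ≤ ⟨M_m(t)⁻¹ δσ_m(t), δω(t)⟩ for all t. -/

import Mathlib

open Matrix

section QuadraticForms

variable {ι κ : Type*} [Fintype ι]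

lemma HasDerivAt.dotProduct_vec {u v : ℝ → ι → ℝ} {u' v' : ι → ℝ} {t : ℝ}
    (hu : HasDerivAt u u' t) (hv : HasDerivAt v v' t) :
    HasDerivAt (fun s => u s ⬝ᵥ v s) (u' ⬝ᵥ v t + u t ⬝ᵥ v') t := by
  rw [hasDerivAt_pi] at hu hv
  simp only [dotProduct, ← Finset.sum_add_distrib]
  exact HasDerivAt.fun_sum fun i _ => (hu i).mul (hv i)

lemma HasDerivAt.mulVec_of_entries {M : ℝ → Matrix κ ι ℝ} {M' : Matrix κ ι ℝ}
    {v : ℝ → ι → ℝ} {v' : ι → ℝ} {t : ℝ}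
    (hM : ∀ i j, HasDerivAt (fun s => M s i j) (M' i j) t) (hv : HasDerivAt v v' t) :
    HasDerivAt (fun s => M s *ᵥ v s) (M' *ᵥ v t + M t *ᵥ v') t :=
  hasDerivAt_pi.2 fun i => HasDerivAt.dotProduct_vec (hasDerivAt_pi.2 fun j => hM i j) hv

lemma Matrix.dotProduct_mulVec_comm_of_symm {P : Matrix ι ι ℝ} (hP : Pᵀ = P) (u v : ι → ℝ) :
    u ⬝ᵥ P *ᵥ v = v ⬝ᵥ P *ᵥ u := by
  rw [dotProduct_mulVec, ← mulVec_transpose, hP, dotProduct_comm]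

lemma Matrix.dotProduct_mulVec_self_of_skew {S : Matrix ι ι ℝ} (hS : Sᵀ = -S) (z : ι → ℝ) :
    z ⬝ᵥ S *ᵥ z = 0 := by
  have h : z ⬝ᵥ S *ᵥ z = -(z ⬝ᵥ S *ᵥ z) := by
    conv_lhs => rw [dotProduct_mulVec, ← mulVec_transpose, hS, dotProduct_comm, neg_mulVec,
      dotProduct_neg]
  linarith

lemma hasDerivAt_quadraticForm {P : ℝ → Matrix ι ι ℝ} {P' : Matrix ι ι ℝ}
    {v : ℝ → ι → ℝ} {v' : ι → ℝ} {t : ℝ} (hsymm : (P t)ᵀ = P t)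
    (hP : ∀ i j, HasDerivAt (fun s => P s i j) (P' i j) t) (hv : HasDerivAt v v' t) :
    HasDerivAt (fun s => v s ⬝ᵥ P s *ᵥ v s) (v t ⬝ᵥ P' *ᵥ v t + 2 * (v t ⬝ᵥ P t *ᵥ v')) t := by
  refine (hv.dotProduct_vec (HasDerivAt.mulVec_of_entries hP hv)).congr_deriv ?_
  rw [dotProduct_add, dotProduct_mulVec_comm_of_symm hsymm v' (v t)]
  ring

variable [DecidableEq ι]

lemma Matrix.isUnit_det_of_dotProduct_mulVec_pos {M : Matrix ι ι ℝ}
    (hM : ∀ z : ι → ℝ, z ≠ 0 → 0 < z ⬝ᵥ M *ᵥ z) : IsUnit M.det := by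
  rw [isUnit_iff_ne_zero]
  intro h
  obtain ⟨z, hz, hMz⟩ := exists_mulVec_eq_zero_iff.2 h
  simpa [hMz] using hM z hz

lemma differentiableAt_matrix_inv_apply {M : ℝ → Matrix ι ι ℝ} {t : ℝ}
    (hM : ∀ i j, DifferentiableAt ℝ (fun s => M s i j) t) (hdet : IsUnit (M t).det) (i j : ι) :
    DifferentiableAt ℝ (fun s => (M s)⁻¹ i j) t := by
  have det_diff : ∀ N : ℝ → Matrix ι ι ℝ, (∀ i j, DifferentiableAt ℝ (fun s => N s i j) t) →
      DifferentiableAt ℝ (fun s => (N s).det) t := by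
    intro N hN
    simp only [det_apply']
    fun_prop
  simp only [inv_def, Ring.inverse_eq_inv', Matrix.smul_apply, smul_eq_mul, adjugate_apply]
  refine ((det_diff M hM).inv hdet.ne_zero).mul (det_diff _ fun k l => ?_)
  by_cases hk : k = j
  · simp [updateRow_apply, hk]
  · simpa [updateRow_apply, hk] using hM k l

lemma hasDerivAt_inv_quadraticForm {M : ℝ → Matrix ι ι ℝ} {M' : Matrix ι ι ℝ}
    {v : ℝ → ι → ℝ} {v' : ι → ℝ} {t : ℝ} (hsymm : (M t)ᵀ = M t)
    (hdet : ∀ s, IsUnit (M s).det)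
    (hM : ∀ i j, HasDerivAt (fun s => M s i j) (M' i j) t) (hv : HasDerivAt v v' t) :
    HasDerivAt (fun s => v s ⬝ᵥ (M s)⁻¹ *ᵥ v s)
      (2 * ((M t)⁻¹ *ᵥ v t ⬝ᵥ v') - (M t)⁻¹ *ᵥ v t ⬝ᵥ M' *ᵥ ((M t)⁻¹ *ᵥ v t)) t := by
  have hx := HasDerivAt.mulVec_of_entries (M := fun s => (M s)⁻¹)
    (M' := of fun i j => deriv (fun s => (M s)⁻¹ i j) t) (fun i j =>
      (differentiableAt_matrix_inv_apply (fun i j => (hM i j).differentiableAt)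
        (hdet t) i j).hasDerivAt) hv
  set x' := (of fun i j => deriv (fun s => (M s)⁻¹ i j) t) *ᵥ v t + (M t)⁻¹ *ᵥ v'
  have hMx : ∀ s, M s *ᵥ ((M s)⁻¹ *ᵥ v s) = v s := fun s => by
    rw [mulVec_mulVec, mul_nonsing_inv _ (hdet s), one_mulVec]
  have hv' : v' = M' *ᵥ ((M t)⁻¹ *ᵥ v t) + M t *ᵥ x' := by
    have h := HasDerivAt.mulVec_of_entries hM hx
    simp only [hMx] at h
    exact hv.unique h
  have hvx : v t ⬝ᵥ x' = (M t)⁻¹ *ᵥ v t ⬝ᵥ M t *ᵥ x' := by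
    rw [dotProduct_mulVec_comm_of_symm hsymm, hMx, dotProduct_comm]
  refine (hv.dotProduct_vec hx).congr_deriv ?_
  rw [hvx, dotProduct_comm v', hv', dotProduct_add]
  ring

end QuadraticForms

section Dissipation

variable {ι : Type*} [Fintype ι]

lemma Matrix.quadraticForm_contraction_le {P P' A : Matrix ι ι ℝ} (hP : Pᵀ = P) {z : ι → ℝ}
    (hA : z ⬝ᵥ (P' - P * A - Aᵀ * P) *ᵥ z ≤ 0) :
    z ⬝ᵥ P' *ᵥ z ≤ 2 * (z ⬝ᵥ P *ᵥ (A *ᵥ z)) := by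
  have h : z ⬝ᵥ (Aᵀ * P) *ᵥ z = z ⬝ᵥ P *ᵥ (A *ᵥ z) := by
    rw [← mulVec_mulVec, dotProduct_mulVec, vecMul_transpose, dotProduct_mulVec_comm_of_symm hP]
  rw [sub_mulVec, sub_mulVec, dotProduct_sub, dotProduct_sub, h, ← mulVec_mulVec] at hA
  linarith

lemma Matrix.dotProduct_damping_ge {S M' D Kd : Matrix ι ι ℝ} (hS : Sᵀ = -S) {x : ι → ℝ}
    (hD : 0 ≤ x ⬝ᵥ D *ᵥ x) (hKd : 0 ≤ x ⬝ᵥ Kd *ᵥ x) :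
    -(x ⬝ᵥ M' *ᵥ x) ≤ 2 * (x ⬝ᵥ (S - (1 / 2 : ℝ) • M' + D + Kd) *ᵥ x) := by
  simp only [add_mulVec, sub_mulVec, smul_mulVec, dotProduct_add, dotProduct_sub,
    dotProduct_smul, dotProduct_mulVec_self_of_skew hS, smul_eq_mul]
  linarith

end Dissipation

/-- Proposition 1: differential passivity of the closed-loop variational error dynamics of
the flexible-joint robot, with differential storage `V = V_ℓ + V_m` and output
`δy = M_m⁻¹ δσ_m`. -/
theorem stmt_10 (n : ℕ)
    (Ml Ml' Mm Mm' : ℝ → Matrix (Fin n) (Fin n) ℝ)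
    (hMldiff : ∀ t i j, HasDerivAt (fun s => Ml s i j) (Ml' t i j) t)
    (hMmdiff : ∀ t i j, HasDerivAt (fun s => Mm s i j) (Mm' t i j) t)
    (hMlsymm : ∀ t, (Ml t)ᵀ = Ml t) (hMmsymm : ∀ t, (Mm t)ᵀ = Mm t)
    (hMlpos : ∀ t (z : Fin n → ℝ), z ≠ 0 → 0 < z ⬝ᵥ (Ml t).mulVec z)
    (hMmpos : ∀ t (z : Fin n → ℝ), z ≠ 0 → 0 < z ⬝ᵥ (Mm t).mulVec z)
    (Sl Sm : ℝ → Matrix (Fin n) (Fin n) ℝ)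
    (hSl : ∀ t, (Sl t)ᵀ = -(Sl t)) (hSm : ∀ t, (Sm t)ᵀ = -(Sm t))
    (Dl Dm : ℝ → Matrix (Fin n) (Fin n) ℝ)
    (hDlsymm : ∀ t, (Dl t)ᵀ = Dl t) (hDmsymm : ∀ t, (Dm t)ᵀ = Dm t)
    (hDlpos : ∀ t (z : Fin n → ℝ), 0 ≤ z ⬝ᵥ (Dl t).mulVec z)
    (hDmpos : ∀ t (z : Fin n → ℝ), 0 ≤ z ⬝ᵥ (Dm t).mulVec z)
    (Kld Kmd : Matrix (Fin n) (Fin n) ℝ)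
    (hKldsymm : Kldᵀ = Kld) (hKmdsymm : Kmdᵀ = Kmd)
    (hKldpos : ∀ z : Fin n → ℝ, 0 ≤ z ⬝ᵥ Kld.mulVec z)
    (hKmdpos : ∀ z : Fin n → ℝ, 0 ≤ z ⬝ᵥ Kmd.mulVec z)
    (Pl Pl' Pm Pm' : ℝ → Matrix (Fin n) (Fin n) ℝ)
    (hPldiff : ∀ t i j, HasDerivAt (fun s => Pl s i j) (Pl' t i j) t)
    (hPmdiff : ∀ t i j, HasDerivAt (fun s => Pm s i j) (Pm' t i j) t)
    (hPlsymm : ∀ t, (Pl t)ᵀ = Pl t) (hPmsymm : ∀ t, (Pm t)ᵀ = Pm t)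
    (hPlpos : ∀ t (z : Fin n → ℝ), z ≠ 0 → 0 < z ⬝ᵥ (Pl t).mulVec z)
    (hPmpos : ∀ t (z : Fin n → ℝ), z ≠ 0 → 0 < z ⬝ᵥ (Pm t).mulVec z)
    (Al Am : ℝ → Matrix (Fin n) (Fin n) ℝ)
    (hAl : ∀ t (z : Fin n → ℝ),
      z ⬝ᵥ (Pl' t - Pl t * Al t - (Al t)ᵀ * Pl t).mulVec z ≤ 0)
    (hAm : ∀ t (z : Fin n → ℝ),
      z ⬝ᵥ (Pm' t - Pm t * Am t - (Am t)ᵀ * Pm t).mulVec z ≤ 0)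
    (K : Matrix (Fin n) (Fin n) ℝ)
    (δql δqm δσl δσm : ℝ → Fin n → ℝ) (δω : ℝ → Fin n → ℝ)
    (hδql : ∀ t, HasDerivAt δql (-(Al t).mulVec (δql t) + (Ml t)⁻¹.mulVec (δσl t)) t)
    (hδqm : ∀ t, HasDerivAt δqm
      (-(Am t).mulVec (δqm t) - (Pm t)⁻¹.mulVec (Kᵀ.mulVec ((Ml t)⁻¹.mulVec (δσl t)))
        + (Mm t)⁻¹.mulVec (δσm t)) t)
    (hδσl : ∀ t, HasDerivAt δσl
      (-(Pl t).mulVec (δql t) + K.mulVec (δqm t)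
        - (Sl t - (1 / 2 : ℝ) • Ml' t + Dl t + Kld).mulVec ((Ml t)⁻¹.mulVec (δσl t))) t)
    (hδσm : ∀ t, HasDerivAt δσm
      (-(Pm t).mulVec (δqm t)
        - (Sm t - (1 / 2 : ℝ) • Mm' t + Dm t + Kmd).mulVec ((Mm t)⁻¹.mulVec (δσm t))
        + δω t) t)
    (V : ℝ → ℝ)
    (hV : V = fun t => (1 / 2 : ℝ) * (δql t ⬝ᵥ (Pl t).mulVec (δql t))
      + (1 / 2 : ℝ) * (δσl t ⬝ᵥ (Ml t)⁻¹.mulVec (δσl t))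
      + (1 / 2 : ℝ) * (δqm t ⬝ᵥ (Pm t).mulVec (δqm t))
      + (1 / 2 : ℝ) * (δσm t ⬝ᵥ (Mm t)⁻¹.mulVec (δσm t))) :
    ∀ t, DifferentiableAt ℝ V t ∧ deriv V t ≤ (Mm t)⁻¹.mulVec (δσm t) ⬝ᵥ δω t := by
  intro t
  have hdl s := isUnit_det_of_dotProduct_mulVec_pos (hMlpos s)
  have hdm s := isUnit_det_of_dotProduct_mulVec_pos (hMmpos s)
  have hPdet := isUnit_det_of_dotProduct_mulVec_pos (hPmpos t)
  have hderiv := ((((hasDerivAt_quadraticForm (hPlsymm t) (hPldiff t) (hδql t)).const_mul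
    (1 / 2 : ℝ)).add ((hasDerivAt_inv_quadraticForm (hMlsymm t) hdl (hMldiff t)
    (hδσl t)).const_mul (1 / 2 : ℝ))).add ((hasDerivAt_quadraticForm (hPmsymm t) (hPmdiff t)
    (hδqm t)).const_mul (1 / 2 : ℝ))).add ((hasDerivAt_inv_quadraticForm (hMmsymm t) hdm
    (hMmdiff t) (hδσm t)).const_mul (1 / 2 : ℝ))
  replace hderiv := hderiv.congr_of_eventuallyEq (Filter.EventuallyEq.of_eq hV)
  refine ⟨hderiv.differentiableAt, ?_⟩
  rw [hderiv.deriv]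
  set x := (Ml t)⁻¹ *ᵥ δσl t
  set y := (Mm t)⁻¹ *ᵥ δσm t
  have hl := quadraticForm_contraction_le (hPlsymm t) (hAl t (δql t))
  have hm := quadraticForm_contraction_le (hPmsymm t) (hAm t (δqm t))
  have hdampl := dotProduct_damping_ge (M' := Ml' t) (hSl t) (hDlpos t x) (hKldpos x)
  have hdampm := dotProduct_damping_ge (M' := Mm' t) (hSm t) (hDmpos t y) (hKmdpos y)
  have hPlx := dotProduct_mulVec_comm_of_symm (hPlsymm t) (δql t) x
  have hPmy := dotProduct_mulVec_comm_of_symm (hPmsymm t) (δqm t) y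
  have hstiff : δqm t ⬝ᵥ Pm t *ᵥ ((Pm t)⁻¹ *ᵥ (Kᵀ *ᵥ x)) = x ⬝ᵥ K *ᵥ δqm t := by
    rw [mulVec_mulVec, mul_nonsing_inv _ hPdet, one_mulVec, dotProduct_mulVec, vecMul_transpose,
      dotProduct_comm]
  simp only [mulVec_add, mulVec_sub, mulVec_neg, dotProduct_add, dotProduct_sub, dotProduct_neg]
  linarith
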